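/- Let T be a left-invertible bounded operator on a complex Hilbert space H, with Aluthge transform T̃ = |T|^{1/2} T |T|^{−1/2}. Then T̃ is left-invertible, the operators T*|T|T and L_T|T|T are invertible, and the Shimorin left inverse of T̃ is given by L_{T̃} = |T|^{1/2} (T*|T|T)^{−1} T* |T|^{1/2} = |T|^{1/2} (L_T |T| T)^{−1} L_T |T|^{1/2}. -/

import Mathlib

noncomputable section

/-- The Shimorin left inverse `(T*T)⁻¹ T*` of a left-invertible operator
(`Ring.inverse` returns the junk value `0` when `T*T` is not invertible). -/
noncomputable def shimorinInv {H : Type} [NormedAddCommGroup H] [InnerProductSpace ℂ H]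
    [CompleteSpace H] (T : H →L[ℂ] H) : H →L[ℂ] H :=
  Ring.inverse (ContinuousLinearMap.adjoint T * T) * ContinuousLinearMap.adjoint T

/-- The Aluthge transform `|T|^{1/2} T |T|^{-1/2}` of a left-invertible operator, expressed
in terms of a given positive square root `sq` of `|T|`. -/
noncomputable def aluthge {H : Type} [NormedAddCommGroup H] [InnerProductSpace ℂ H]
    [CompleteSpace H] (sq T : H →L[ℂ] H) : H →L[ℂ] H :=
  sq * T * Ring.inverse sq

section CStarAlgebra

variable {A : Type*} [CStarAlgebra A] [PartialOrder A] [StarOrderedRing A]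

/-- Left-invertibility is preserved when the identity in `star T * 1 * T` is replaced by
a strictly positive element. -/
theorem IsStrictlyPositive.isUnit_star_left_conjugate {a T : A} (ha : IsStrictlyPositive a)
    (hT : IsUnit (star T * T)) : IsUnit (star T * a * T) := by
  nontriviality A
  obtain ⟨r, hr, hra⟩ := (CFC.exists_pos_algebraMap_le_iff ha.isSelfAdjoint).2
    fun x hx => ha.spectrum_pos hx
  have hle : r • (star T * T) ≤ star T * a * T := by
    simpa [Algebra.algebraMap_eq_smul_one] using star_left_conjugate_le_conjugate hra T
  have hpos : IsStrictlyPositive (r • (star T * T)) :=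
    IsStrictlyPositive.smul hr (hT.isStrictlyPositive (star_mul_self_nonneg T))
  exact (hpos.of_le hle).isUnit

end CStarAlgebra

theorem aluthge_shimorin_left_inverse
    {H : Type} [NormedAddCommGroup H] [InnerProductSpace ℂ H] [CompleteSpace H]
    (T : H →L[ℂ] H) (hT : IsUnit (ContinuousLinearMap.adjoint T * T))
    (absT : H →L[ℂ] H) (habs_pos : absT.IsPositive)
    (habs_sq : absT * absT = ContinuousLinearMap.adjoint T * T)
    (sqrtT : H →L[ℂ] H) (hsqrt_pos : sqrtT.IsPositive)
    (hsqrt_sq : sqrtT * sqrtT = absT) :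
    IsUnit (ContinuousLinearMap.adjoint (aluthge sqrtT T) * aluthge sqrtT T) ∧
    IsUnit (ContinuousLinearMap.adjoint T * absT * T) ∧
    IsUnit (shimorinInv T * absT * T) ∧
    shimorinInv (aluthge sqrtT T) =
      sqrtT * (Ring.inverse (ContinuousLinearMap.adjoint T * absT * T) *
        ContinuousLinearMap.adjoint T) * sqrtT ∧
    shimorinInv (aluthge sqrtT T) =
      sqrtT * (Ring.inverse (shimorinInv T * absT * T) * shimorinInv T) * sqrtT := by
  have ha : IsUnit absT := isUnit_mul_self_iff.1 (habs_sq ▸ hT)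
  have hs : IsUnit sqrtT := isUnit_mul_self_iff.1 (hsqrt_sq ▸ ha)
  have hM : IsUnit (ContinuousLinearMap.adjoint T * absT * T) :=
    (ha.isStrictlyPositive
      ((ContinuousLinearMap.nonneg_iff_isPositive _).2 habs_pos)).isUnit_star_left_conjugate hT
  have hL : shimorinInv T * absT * T =
      Ring.inverse (ContinuousLinearMap.adjoint T * T) *
        (ContinuousLinearMap.adjoint T * absT * T) := by
    simp only [shimorinInv, mul_assoc]
  have hadj : ContinuousLinearMap.adjoint (aluthge sqrtT T) =
      Ring.inverse sqrtT * ContinuousLinearMap.adjoint T * sqrtT := by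
    have hss : star sqrtT = sqrtT := hsqrt_pos.isSelfAdjoint
    simp only [aluthge, ← ContinuousLinearMap.star_eq_adjoint, star_mul, ← Ring.inverse_star, hss,
      mul_assoc]
  have hA : ContinuousLinearMap.adjoint (aluthge sqrtT T) * aluthge sqrtT T =
      Ring.inverse sqrtT * (ContinuousLinearMap.adjoint T * absT * T) * Ring.inverse sqrtT := by
    rw [hadj, ← hsqrt_sq]
    simp only [aluthge, mul_assoc]
  have hshim : shimorinInv (aluthge sqrtT T) =
      sqrtT * (Ring.inverse (ContinuousLinearMap.adjoint T * absT * T) *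
        ContinuousLinearMap.adjoint T) * sqrtT := by
    rw [shimorinInv, hA, hadj, Ring.inverse_mul (.inr hs.ringInverse),
      Ring.inverse_mul (.inr hM), Ring.inverse_inverse hs]
    simp only [mul_assoc, Ring.mul_inverse_cancel_left _ _ hs]
  refine ⟨hA ▸ (hs.ringInverse.mul hM).mul hs.ringInverse, hM,
    hL ▸ hT.ringInverse.mul hM, hshim, ?_⟩
  rw [hshim, hL, Ring.inverse_mul (.inr hM), Ring.inverse_inverse hT, shimorinInv, mul_assoc _ _
    (Ring.inverse _ * _), Ring.mul_inverse_cancel_left _ _ hT]
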